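/- arXiv:2407.15542 — 4 statements merged into one kernel-verified Lean document; each statement's English description precedes it below -/
import Mathlib

section
/- In the setting of the primal-dual dynamical system, assume additionally that ∇f is L-Lipschitz continuous for some L > 0. Let (x*, λ*) be a primal-dual solution and t ↦ (x(t), λ(t)) a solution of the system, and let ρ be as follows: ρ = 0 if r = 0, ρ = 1 if r = 1, ρ ∈ (0, r) arbitrary if r ∈ (0,1) (with ρ = r allowed if the trajectory is bounded). Then as t → ∞: t^ρ √(β(t)) ‖∇f(x(t)) − ∇f(x*)‖ → 0 and t^ρ √(β(t)) ‖A*(λ(t) − λ*)‖ → 0. -/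
open Filter Topology Set

/-- The Lyapunov energy of the inertial system at a state with displacement `u`, velocity `z` and
operator value `V`; the weight `τ` scales the velocity and `g` the operator value. -/
noncomputable def energy {H : Type*} [NormedAddCommGroup H] [InnerProductSpace ℝ H]
    (η σ a τ g : ℝ) (u z V : H) : ℝ :=
  1 / 2 * ‖η • u + τ • z + (σ * g) • V‖ ^ 2 + η / 2 * a * ‖u‖ ^ 2
    + (1 - σ) * η * (g * inner ℝ u V) + σ * (1 - σ) / 2 * (g ^ 2 * ‖V‖ ^ 2)

/-- The derivative of `energy` along the flow, see `hasDerivAt_energy`. -/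
noncomputable def energyDeriv {H : Type*} [NormedAddCommGroup H] [InnerProductSpace ℝ H]
    (θ η σ a τ τ'' g m : ℝ) (u z V w : H) : ℝ :=
  -(η / 2 * τ'' * ‖u‖ ^ 2) - η * (m * g / τ) * inner ℝ u V - a * τ * ‖z‖ ^ 2
    - σ * m * (g ^ 2 / τ) * ‖V‖ ^ 2
    - (σ * (m + a) + (1 - σ) * (1 / θ - η)) * (g * inner ℝ z V)
    - (1 - σ) * τ * g * inner ℝ z w

theorem hasDerivAt_energy {H : Type*} [NormedAddCommGroup H] [InnerProductSpace ℝ H]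
    {α θ η σ t τ'' g' : ℝ} {τ τ' g : ℝ → ℝ} {u z V : ℝ → H} {zd w : H}
    (hu : HasDerivAt u (z t) t) (hz : HasDerivAt z zd t) (hV : HasDerivAt V w t)
    (hτ : HasDerivAt τ (τ' t) t) (hτ' : HasDerivAt τ' τ'' t) (hg : HasDerivAt g g' t)
    (hτ0 : τ t ≠ 0) (hg0 : g t ≠ 0) (hθ : θ ≠ 0)
    (heq : τ t • zd + α • z t + g t • w + (g t / (θ * τ t)) • V t = 0) :
    HasDerivAt (fun s => energy η σ (α - τ' s - η) (τ s) (g s) (u s) (z s) (V s))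
      (energyDeriv θ η σ (α - τ' t - η) (τ t) τ'' (g t) (1 / θ - τ t * g' / g t)
        (u t) (z t) (V t) w) t := by
  have hzd : zd = (τ t)⁻¹ • (-(α • z t + g t • w + (g t / (θ * τ t)) • V t)) := by
    rw [eq_inv_smul_iff₀ hτ0, eq_neg_iff_add_eq_zero, ← heq]; abel
  have h1 := (((hu.const_smul η).add (hτ.smul hz)).add ((hg.const_mul σ).smul hV)).norm_sq
  have h2 := ((((hτ'.const_sub α).sub_const η).const_mul (η / 2)).mul hu.norm_sq)
  have h3 := (hg.mul (hu.inner ℝ hV)).const_mul ((1 - σ) * η)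
  have h4 := ((hg.pow 2).mul hV.norm_sq).const_mul (σ * (1 - σ) / 2)
  refine (((h1.const_mul (1 / 2)).add h2).add h3).add h4 |>.congr_deriv ?_
  subst hzd
  simp only [energyDeriv, Pi.add_apply, Pi.smul_apply, Pi.smul_apply', Pi.pow_apply,
    inner_add_left, inner_add_right, real_inner_smul_left, real_inner_smul_right,
    inner_neg_right, real_inner_self_eq_norm_sq]
  rw [real_inner_comm (z t) (V t)]
  field_simp
  ring

theorem antitoneOn_Ici_of_hasDerivAt_nonpos {f f' : ℝ → ℝ} {a : ℝ}
    (hf : ∀ t ∈ Ici a, HasDerivAt f (f' t) t) (hf' : ∀ t ∈ Ici a, f' t ≤ 0) :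
    AntitoneOn f (Ici a) :=
  antitoneOn_of_hasDerivWithinAt_nonpos (convex_Ici a)
    (fun t ht => (hf t ht).continuousAt.continuousWithinAt)
    (fun t ht => (hf t (interior_subset ht)).hasDerivWithinAt)
    (fun t ht => hf' t (interior_subset ht))

theorem AntitoneOn.exists_tendsto_atTop {f : ℝ → ℝ} {a : ℝ} (hf : AntitoneOn f (Ici a))
    (h0 : ∀ t ∈ Ici a, 0 ≤ f t) : ∃ l, Tendsto f atTop (𝓝 l) := by
  have hanti : Antitone fun t => f (max a t) := fun s t hst =>
    hf (mem_Ici.2 (le_max_left _ _)) (mem_Ici.2 (le_max_left _ _)) (max_le_max_left a hst)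
  have hbdd : BddBelow (range fun t => f (max a t)) :=
    ⟨0, by rintro _ ⟨t, rfl⟩; exact h0 _ (mem_Ici.2 (le_max_left _ _))⟩
  refine ⟨_, (tendsto_atTop_ciInf hanti hbdd).congr' ?_⟩
  filter_upwards [eventually_ge_atTop a] with t ht
  rw [max_eq_right ht]

/-- If `W ≥ 0` dissipates at rate `S`, and `F ≥ 0` is controlled by `t S` and grows at rate at
most `S`, then `F` vanishes at infinity, since `1 / t` is not integrable. -/
theorem tendsto_zero_of_dissipation {W W' F F' S : ℝ → ℝ} {a e K C : ℝ} (ha : 0 < a)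
    (he : 0 < e) (hK : 0 ≤ K) (hC : 0 < C)
    (hW : ∀ t ∈ Ici a, HasDerivAt W (W' t) t) (hF : ∀ t ∈ Ici a, HasDerivAt F (F' t) t)
    (hW0 : ∀ t ∈ Ici a, 0 ≤ W t) (hF0 : ∀ t ∈ Ici a, 0 ≤ F t)
    (hS0 : ∀ t ∈ Ici a, 0 ≤ S t)
    (hW' : ∀ t ∈ Ici a, W' t ≤ -(e * S t)) (hF' : ∀ t ∈ Ici a, F' t ≤ K * S t)
    (hFS : ∀ t ∈ Ici a, F t ≤ C * (t * S t)) : Tendsto F atTop (𝓝 0) := by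
  obtain ⟨w, hw⟩ := (antitoneOn_Ici_of_hasDerivAt_nonpos hW fun t ht => by
    have := mul_nonneg he.le (hS0 t ht); linarith [hW' t ht]).exists_tendsto_atTop hW0
  obtain ⟨q, hq⟩ := (antitoneOn_Ici_of_hasDerivAt_nonpos
    (fun t ht => (hF t ht).add ((hW t ht).const_mul (K / e))) fun t ht => by
      have h1 := mul_le_mul_of_nonneg_left (hW' t ht) (div_nonneg hK he.le)
      have h2 : K / e * -(e * S t) = -(K * S t) := by field_simp
      linarith [hF' t ht]).exists_tendsto_atTop fun t ht =>
        add_nonneg (hF0 t ht) (mul_nonneg (div_nonneg hK he.le) (hW0 t ht))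
  have hlim : Tendsto F atTop (𝓝 (q - K / e * w)) :=
    (hq.sub (hw.const_mul (K / e))).congr fun t => by simp
  have hl0 : 0 ≤ q - K / e * w :=
    ge_of_tendsto hlim ((eventually_ge_atTop a).mono hF0)
  generalize q - K / e * w = l at hlim hl0
  rcases hl0.eq_or_lt with rfl | hl
  · exact hlim
  exfalso
  obtain ⟨b, hab, hb⟩ : ∃ b ≥ a, ∀ t ≥ b, l / 2 ≤ F t := by
    obtain ⟨b, hb⟩ := eventually_atTop.1 (hlim.eventually_const_le (half_lt_self hl))
    exact ⟨max a b, le_max_left _ _, fun t ht => hb t (le_trans (le_max_right _ _) ht)⟩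
  have hc : 0 < e * (l / 2) / C := by positivity
  have hanti : AntitoneOn (fun t => W t + e * (l / 2) / C * Real.log t) (Ici b) := by
    refine antitoneOn_Ici_of_hasDerivAt_nonpos (fun t ht => (hW t (hab.trans ht)).add
      ((Real.hasDerivAt_log (ha.trans_le (hab.trans ht)).ne').const_mul _)) fun t ht => ?_
    have ht0 : 0 < t := ha.trans_le (hab.trans ht)
    have h1 : l / 2 ≤ C * (t * S t) := (hb t ht).trans (hFS t (hab.trans ht))
    have h2 : e * (l / 2) / C * t⁻¹ ≤ e * S t := by
      rw [← div_eq_mul_inv, div_div, div_le_iff₀ (by positivity)]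
      nlinarith [mul_le_mul_of_nonneg_left h1 he.le]
    linarith [hW' t (hab.trans ht)]
  have hlog := (Real.tendsto_log_atTop.const_mul_atTop hc).eventually_gt_atTop
    (W b + e * (l / 2) / C * Real.log b)
  obtain ⟨t, ht, htb⟩ := (hlog.and (eventually_ge_atTop b)).exists
  have h1 : W t + _ ≤ W b + _ := hanti (mem_Ici.2 le_rfl) htb htb
  linarith [hW0 t (hab.trans htb)]

theorem mul_abs_inner_le {H : Type*} [NormedAddCommGroup H] [InnerProductSpace ℝ H]
    {τ g s : ℝ} (hτ : 0 < τ) (hg : 0 ≤ g) (hs : 0 < s) (z V : H) :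
    g * |inner ℝ z V| ≤ (s * (τ * ‖z‖ ^ 2) + s⁻¹ * (g ^ 2 / τ * ‖V‖ ^ 2)) / 2 := by
  have h1 : g * |inner ℝ z V| ≤ g * (‖z‖ * ‖V‖) :=
    mul_le_mul_of_nonneg_left (abs_real_inner_le_norm z V) hg
  have h2 : (s * (τ * ‖z‖ ^ 2) + s⁻¹ * (g ^ 2 / τ * ‖V‖ ^ 2)) / 2 - g * (‖z‖ * ‖V‖)
      = (s * τ * ‖z‖ - g * ‖V‖) ^ 2 / (2 * s * τ) := by
    field_simp; ring
  have : 0 ≤ (s * τ * ‖z‖ - g * ‖V‖) ^ 2 / (2 * s * τ) := by positivity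
  linarith

theorem le_energy {H : Type*} [NormedAddCommGroup H] [InnerProductSpace ℝ H]
    {η σ a τ g : ℝ} {u z V : H} (hη : 0 ≤ η) (hσ0 : 0 ≤ σ) (hσ1 : σ ≤ 1) (hg : 0 ≤ g)
    (huV : 0 ≤ inner ℝ u V) : η / 2 * a * ‖u‖ ^ 2 ≤ energy η σ a τ g u z V := by
  have hσ : 0 ≤ 1 - σ := by linarith
  have h1 : 0 ≤ 1 / 2 * ‖η • u + τ • z + (σ * g) • V‖ ^ 2 := by positivity
  have h2 : 0 ≤ (1 - σ) * η * (g * inner ℝ u V) := by positivity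
  have h3 : 0 ≤ σ * (1 - σ) / 2 * (g ^ 2 * ‖V‖ ^ 2) := by positivity
  unfold energy
  linarith

theorem le_energy_zero {H : Type*} [NormedAddCommGroup H] [InnerProductSpace ℝ H]
    {σ a τ g : ℝ} {u z V : H} :
    σ * (1 - σ) / 2 * (g * ‖V‖) ^ 2 ≤ energy 0 σ a τ g u z V := by
  have h1 : 0 ≤ 1 / 2 * ‖(0 : ℝ) • u + τ • z + (σ * g) • V‖ ^ 2 := by positivity
  unfold energy
  linarith

theorem energy_zero_le {H : Type*} [NormedAddCommGroup H] [InnerProductSpace ℝ H]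
    {σ a τ g : ℝ} {u z V : H} (hσ0 : 0 ≤ σ) (hσ1 : σ ≤ 1) (hτ : 0 < τ) :
    energy 0 σ a τ g u z V ≤ τ * (τ * ‖z‖ ^ 2 + g ^ 2 / τ * ‖V‖ ^ 2) := by
  have h1 := parallelogram_law_with_norm ℝ (τ • z) ((σ * g) • V)
  have h2 : 0 ≤ ‖τ • z - (σ * g) • V‖ * ‖τ • z - (σ * g) • V‖ := by positivity
  have h3 : ‖τ • z‖ * ‖τ • z‖ = τ ^ 2 * ‖z‖ ^ 2 := by
    rw [norm_smul, Real.norm_eq_abs, ← sq, mul_pow, sq_abs]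
  have h4 : ‖(σ * g) • V‖ * ‖(σ * g) • V‖ = σ ^ 2 * (g ^ 2 * ‖V‖ ^ 2) := by
    rw [norm_smul, Real.norm_eq_abs, ← sq, mul_pow, sq_abs]; ring
  have h5 : τ * (τ * ‖z‖ ^ 2 + g ^ 2 / τ * ‖V‖ ^ 2) = τ ^ 2 * ‖z‖ ^ 2 + g ^ 2 * ‖V‖ ^ 2 := by
    field_simp
  have h6 : (σ ^ 2 + σ * (1 - σ) / 2) * (g ^ 2 * ‖V‖ ^ 2) ≤ 1 * (g ^ 2 * ‖V‖ ^ 2) :=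
    mul_le_mul_of_nonneg_right (by nlinarith) (by positivity)
  simp only [energy, zero_smul, zero_add]
  rw [h5]
  linarith [sq ‖τ • z + (σ * g) • V‖]

theorem energyDeriv_le {H : Type*} [NormedAddCommGroup H] [InnerProductSpace ℝ H]
    {θ σ a a₀ τ τ'' g m δ M e : ℝ} {u z V w : H} (hθ : 0 < θ) (hσ0 : 0 ≤ σ) (hσ1 : σ ≤ 1)
    (hτ : 0 < τ) (hg : 0 < g) (hδ : 0 < δ) (hm : δ ≤ m) (ha₀ : 0 < a₀) (ha : a₀ ≤ a)
    (hM : m + a ≤ M) (hσM : σ * M ^ 2 ≤ a₀ * δ) (hea : e ≤ a₀ / 2) (heδ : e ≤ σ * δ / 2)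
    (huV : 0 ≤ inner ℝ u V) (hzw : 0 ≤ inner ℝ z w) :
    energyDeriv θ (1 / θ) σ a τ τ'' g m u z V w ≤ -(1 / θ / 2 * τ'' * ‖u‖ ^ 2)
      - e * (τ * ‖z‖ ^ 2 + g ^ 2 / τ * ‖V‖ ^ 2) := by
  have hm0 : 0 < m := by linarith
  have hM0 : 0 < M := by linarith
  have hma : 0 ≤ m + a := by linarith
  have hσ : 0 ≤ 1 - σ := by linarith
  have h1 : 0 ≤ 1 / θ * (m * g / τ) * inner ℝ u V := by positivity
  have h2 : 0 ≤ (1 - σ) * τ * g * inner ℝ z w := by positivity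
  have h3 := mul_abs_inner_le hτ hg.le (div_pos hM0 hδ) z V
  have hX : 0 ≤ τ * ‖z‖ ^ 2 := by positivity
  have hY : 0 ≤ g ^ 2 / τ * ‖V‖ ^ 2 := by positivity
  have h4 : -(σ * (m + a) * (g * inner ℝ z V)) ≤ σ * M * (g * |inner ℝ z V|) := by
    calc -(σ * (m + a) * (g * inner ℝ z V)) = σ * (m + a) * (g * -inner ℝ z V) := by ring
      _ ≤ σ * (m + a) * (g * |inner ℝ z V|) := by gcongr; exact neg_le_abs (inner ℝ z V)
      _ ≤ _ := by gcongr
  have h5 := mul_le_mul_of_nonneg_left h3 (mul_nonneg hσ0 hM0.le)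
  have h6 : σ * M * ((M / δ * (τ * ‖z‖ ^ 2) + (M / δ)⁻¹ * (g ^ 2 / τ * ‖V‖ ^ 2)) / 2)
      = σ * M ^ 2 / δ / 2 * (τ * ‖z‖ ^ 2) + σ * δ / 2 * (g ^ 2 / τ * ‖V‖ ^ 2) := by
    field_simp
  have h7 : σ * M ^ 2 / δ ≤ a₀ := (div_le_iff₀ hδ).2 hσM
  have h8 : σ * δ ≤ σ * m := mul_le_mul_of_nonneg_left hm hσ0
  have h9 : e * (τ * ‖z‖ ^ 2) ≤ (a - σ * M ^ 2 / δ / 2) * (τ * ‖z‖ ^ 2) :=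
    mul_le_mul_of_nonneg_right (by linarith) hX
  have h10 : e * (g ^ 2 / τ * ‖V‖ ^ 2) ≤ (σ * m - σ * δ / 2) * (g ^ 2 / τ * ‖V‖ ^ 2) :=
    mul_le_mul_of_nonneg_right (by linarith) hY
  simp only [energyDeriv, sub_self, mul_zero, add_zero]
  linarith

theorem energyDeriv_zero_le {H : Type*} [NormedAddCommGroup H] [InnerProductSpace ℝ H]
    {θ σ a τ τ'' g m M : ℝ} {u z V w : H} (hθ : 0 < θ) (hσ0 : 0 ≤ σ) (hσ1 : σ ≤ 1)
    (hτ : 0 < τ) (hg : 0 < g) (hm : 0 ≤ m) (ha : 0 ≤ a) (hM : m + a ≤ M) (hθM : 1 / θ ≤ M)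
    (hzw : 0 ≤ inner ℝ z w) :
    energyDeriv θ 0 σ a τ τ'' g m u z V w ≤ M * (τ * ‖z‖ ^ 2 + g ^ 2 / τ * ‖V‖ ^ 2) := by
  have hσ : 0 ≤ 1 - σ := by linarith
  have hM0 : 0 ≤ M := by linarith
  have h2 : 0 ≤ (1 - σ) * τ * g * inner ℝ z w := by positivity
  have h3 := mul_abs_inner_le hτ hg.le one_pos z V
  have hX : 0 ≤ a * τ * ‖z‖ ^ 2 := by positivity
  have hY : 0 ≤ σ * m * (g ^ 2 / τ) * ‖V‖ ^ 2 := by positivity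
  have hS : 0 ≤ M * (τ * ‖z‖ ^ 2 + g ^ 2 / τ * ‖V‖ ^ 2) := by positivity
  have h4 : -((σ * (m + a) + (1 - σ) * (1 / θ)) * (g * inner ℝ z V))
      ≤ M * (g * |inner ℝ z V|) := by
    calc -((σ * (m + a) + (1 - σ) * (1 / θ)) * (g * inner ℝ z V))
        = (σ * (m + a) + (1 - σ) * (1 / θ)) * (g * -inner ℝ z V) := by ring
      _ ≤ (σ * (m + a) + (1 - σ) * (1 / θ)) * (g * |inner ℝ z V|) := by
        gcongr; exact neg_le_abs (inner ℝ z V)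
      _ ≤ _ := by
        gcongr
        nlinarith [mul_le_mul_of_nonneg_left hM hσ0, mul_le_mul_of_nonneg_left hθM hσ]
  have h5 := mul_le_mul_of_nonneg_left h3 hM0
  simp only [energyDeriv, sub_zero, zero_div, zero_mul, neg_zero, zero_sub]
  simp only [one_mul, inv_one] at h5
  linarith

theorem tendsto_zero_and_bounded_of_inertial {H : Type*} [NormedAddCommGroup H]
    [InnerProductSpace ℝ H]
    {α θ t₁ a₀ δ : ℝ} {τ τ' τ'' g g' : ℝ → ℝ} {u z z' V w : ℝ → H}
    (ht₁ : 0 < t₁) (hθ : 0 < θ) (ha₀ : 0 < a₀) (hδ : 0 < δ)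
    (hu : ∀ t ∈ Ici t₁, HasDerivAt u (z t) t) (hz : ∀ t ∈ Ici t₁, HasDerivAt z (z' t) t)
    (hV : ∀ t ∈ Ici t₁, HasDerivAt V (w t) t) (hτ : ∀ t ∈ Ici t₁, HasDerivAt τ (τ' t) t)
    (hτ' : ∀ t ∈ Ici t₁, HasDerivAt τ' (τ'' t) t) (hg : ∀ t ∈ Ici t₁, HasDerivAt g (g' t) t)
    (hτ0 : ∀ t ∈ Ici t₁, 0 < τ t) (hτt : ∀ t ∈ Ici t₁, τ t ≤ t)
    (hτ'0 : ∀ t ∈ Ici t₁, 0 ≤ τ' t) (hτ''0 : ∀ t ∈ Ici t₁, τ'' t ≤ 0)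
    (hg0 : ∀ t ∈ Ici t₁, 0 < g t) (hg'0 : ∀ t ∈ Ici t₁, 0 ≤ g' t)
    (ha : ∀ t ∈ Ici t₁, a₀ ≤ α - τ' t - 1 / θ)
    (hm : ∀ t ∈ Ici t₁, δ ≤ 1 / θ - τ t * g' t / g t)
    (huV : ∀ t ∈ Ici t₁, 0 ≤ inner ℝ (u t) (V t))
    (hzw : ∀ t ∈ Ici t₁, 0 ≤ inner ℝ (z t) (w t))
    (heq : ∀ t ∈ Ici t₁,
      τ t • z' t + α • z t + g t • w t + (g t / (θ * τ t)) • V t = 0) :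
    Tendsto (fun t => g t * ‖V t‖) atTop (𝓝 0) ∧ ∃ M, ∀ t ∈ Ici t₁, ‖u t‖ ≤ M := by
  have hθi : 0 < 1 / θ := by positivity
  have hα : 0 < α := by linarith [ha t₁ self_mem_Ici, hτ'0 t₁ self_mem_Ici]
  obtain ⟨M, hM⟩ : ∃ M, M = 1 / θ + α := ⟨_, rfl⟩
  have hM0 : 0 < M := by linarith
  obtain ⟨σ, hσ0, hσ2, hσM⟩ : ∃ σ > 0, σ ≤ 1 / 2 ∧ σ * M ^ 2 ≤ a₀ * δ := by
    refine ⟨min (1 / 2) (a₀ * δ / M ^ 2), by positivity, min_le_left _ _, ?_⟩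
    rw [← le_div_iff₀ (by positivity)]; exact min_le_right _ _
  have hσ1 : 0 < 1 - σ := by linarith
  obtain ⟨e, he0, hea, heδ⟩ : ∃ e > 0, e ≤ a₀ / 2 ∧ e ≤ σ * δ / 2 :=
    ⟨min (a₀ / 2) (σ * δ / 2), by positivity, min_le_left _ _, min_le_right _ _⟩
  have hη : 0 ≤ 1 / θ := hθi.le
  have hσ1' : σ ≤ 1 := by linarith
  have hS0 : ∀ t ∈ Ici t₁, 0 ≤ τ t * ‖z t‖ ^ 2 + g t ^ 2 / τ t * ‖V t‖ ^ 2 := fun t ht => by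
    have := hτ0 t ht; positivity
  have hm1 : ∀ t ∈ Ici t₁, 1 / θ - τ t * g' t / g t ≤ 1 / θ := fun t ht => by
    have := hτ0 t ht; have := hg0 t ht; have := hg'0 t ht
    rw [sub_le_self_iff]; positivity
  have hEd := fun η t ht => hasDerivAt_energy (η := η) (σ := σ) (hu t ht) (hz t ht) (hV t ht)
    (hτ t ht) (hτ' t ht) (hg t ht) (hτ0 t ht).ne' (hg0 t ht).ne' hθ.ne' (heq t ht)
  have hElow := fun t (ht : t ∈ Ici t₁) => le_energy (a := α - τ' t - 1 / θ) (τ := τ t)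
    (z := z t) hη hσ0.le hσ1' (hg0 t ht).le (huV t ht)
  have hWd := fun t ht => (hEd (1 / θ) t ht).fun_div
    (((hτ' t ht).const_sub α).sub_const (1 / θ)) (ha₀.trans_le (ha t ht)).ne'
  have hWlow : ∀ t ∈ Ici t₁, 1 / θ / 2 * ‖u t‖ ^ 2 ≤ energy (1 / θ) σ (α - τ' t - 1 / θ) (τ t)
      (g t) (u t) (z t) (V t) / (α - τ' t - 1 / θ) := fun t ht => by
    rw [le_div_iff₀ (ha₀.trans_le (ha t ht))]
    linarith [hElow t ht]
  have hW' : ∀ t ∈ Ici t₁,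
      (energyDeriv θ (1 / θ) σ (α - τ' t - 1 / θ) (τ t) (τ'' t) (g t) (1 / θ - τ t * g' t / g t)
          (u t) (z t) (V t) (w t) * (α - τ' t - 1 / θ)
        - energy (1 / θ) σ (α - τ' t - 1 / θ) (τ t) (g t) (u t) (z t) (V t) * -τ'' t)
          / (α - τ' t - 1 / θ) ^ 2
      ≤ -(e / α * (τ t * ‖z t‖ ^ 2 + g t ^ 2 / τ t * ‖V t‖ ^ 2)) := fun t ht => by
    have hD := energyDeriv_le (τ'' := τ'' t) (M := M) hθ hσ0.le hσ1' (hτ0 t ht) (hg0 t ht) hδ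
      (hm t ht) ha₀ (ha t ht) (by linarith [hm1 t ht, hτ'0 t ht]) hσM hea heδ (huV t ht) (hzw t ht)
    have hE := hElow t ht
    have ha1 : α - τ' t - 1 / θ ≤ α := by linarith [hτ'0 t ht]
    have ha2 := ha₀.trans_le (ha t ht)
    have hS := hS0 t ht
    generalize energy (1 / θ) σ (α - τ' t - 1 / θ) (τ t) (g t) (u t) (z t) (V t) = E at *
    generalize α - τ' t - 1 / θ = a at *
    generalize τ t * ‖z t‖ ^ 2 + g t ^ 2 / τ t * ‖V t‖ ^ 2 = S at *
    have h1 := mul_le_mul_of_nonneg_right hD ha2.le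
    have h2 := mul_le_mul_of_nonneg_right hE (neg_nonneg.2 (hτ''0 t ht))
    have h3 : e / α * S * a ^ 2 ≤ e * S * a := by
      rw [div_mul_eq_mul_div, div_mul_eq_mul_div, div_le_iff₀ hα, sq, ← mul_assoc]
      exact mul_le_mul_of_nonneg_left ha1 (by positivity)
    rw [div_le_iff₀ (by positivity)]
    linarith
  have hF : Tendsto (fun t => energy 0 σ (α - τ' t - 0) (τ t) (g t) (u t) (z t) (V t)) atTop
      (𝓝 0) :=
    tendsto_zero_of_dissipation ht₁ (div_pos he0 hα) hM0.le one_pos hWd (hEd 0)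
      (fun t ht => le_trans (by positivity) (hWlow t ht))
      (fun t ht => le_trans (by positivity) le_energy_zero) hS0 hW'
      (fun t ht => energyDeriv_zero_le hθ hσ0.le hσ1' (hτ0 t ht) (hg0 t ht)
        (hδ.le.trans (hm t ht)) (by linarith [ha t ht])
        (by linarith [hm1 t ht, hτ'0 t ht]) (by linarith) (hzw t ht))
      (fun t ht => by
        rw [one_mul]
        exact (energy_zero_le hσ0.le hσ1' (hτ0 t ht)).trans
          (mul_le_mul_of_nonneg_right (hτt t ht) (hS0 t ht)))
  constructor
  · have h1 : Tendsto (fun t => (g t * ‖V t‖) ^ 2) atTop (𝓝 0) := by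
      refine squeeze_zero (fun t => by positivity) (fun t => ?_)
        (by simpa only [mul_zero] using hF.const_mul (σ * (1 - σ) / 2)⁻¹)
      rw [inv_mul_eq_div, le_div_iff₀' (by positivity)]
      exact le_energy_zero
    refine squeeze_zero_norm (fun t => ?_) (by simpa using h1.sqrt)
    rw [Real.sqrt_sq_eq_abs, Real.norm_eq_abs]
  · have hanti := antitoneOn_Ici_of_hasDerivAt_nonpos hWd fun t ht => (hW' t ht).trans (by
      have := hS0 t ht
      rw [neg_nonpos]; positivity)
    refine ⟨√(energy (1 / θ) σ (α - τ' t₁ - 1 / θ) (τ t₁) (g t₁) (u t₁) (z t₁) (V t₁)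
      / (α - τ' t₁ - 1 / θ) / (1 / θ / 2)), fun t ht => Real.le_sqrt_of_sq_le ?_⟩
    rw [le_div_iff₀' (by positivity)]
    exact (hWlow t ht).trans (hanti self_mem_Ici ht ht)

theorem tendsto_zero_and_bounded_of_rpow {H : Type*} [NormedAddCommGroup H]
    [InnerProductSpace ℝ H] {t₀ r α θ : ℝ} (hr0 : 0 ≤ r) (hr1 : r ≤ 1)
    (hα : 0 < α) (hθ : 0 < θ)
    (hparam : (r < 1 → 2 / α < θ) ∧ (r = 1 → 2 / (α + 1) ≤ θ ∧ θ < 1 / 2))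
    {β β' : ℝ → ℝ} (hβpos : ∀ t ∈ Ici t₀, 0 < β t) (hβmono : MonotoneOn β (Ici t₀))
    (hβderiv : ∀ t ∈ Ici t₀, HasDerivAt β (β' t) t)
    (hgrowth : ∃ c, c < 1 / θ ∧ ∀ t ∈ Ici t₀, t ^ r * (β' t / β t + 2 * r / t) ≤ c)
    {u z z' V w : ℝ → H}
    (hu : ∀ t ∈ Ici t₀, HasDerivAt u (z t) t) (hz : ∀ t ∈ Ici t₀, HasDerivAt z (z' t) t)
    (hV : ∀ t ∈ Ici t₀, HasDerivAt V (w t) t)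
    (huV : ∀ t ∈ Ici t₀, 0 ≤ inner ℝ (u t) (V t))
    (hzw : ∀ t ∈ Ici t₀, 0 ≤ inner ℝ (z t) (w t))
    (heq : ∀ t ∈ Ici t₀,
      z' t + (α / t ^ r) • z t + (θ * t ^ r * β t) • w t + β t • V t = 0) :
    Tendsto (fun t => t ^ (2 * r) * β t * ‖V t‖) atTop (𝓝 0) ∧
      ∃ M, ∀ᶠ t in atTop, ‖u t‖ ≤ M := by
  obtain ⟨c, hc, hgrowth⟩ := hgrowth
  obtain ⟨a₀, ha₀, ha⟩ : ∃ a₀ > 0, ∀ᶠ t : ℝ in atTop, a₀ ≤ α - r * t ^ (r - 1) - 1 / θ := by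
    rcases hr1.lt_or_eq with hr | rfl
    · have h1 : 1 / θ < α := by
        have := hparam.1 hr
        rw [div_lt_iff₀ hα] at this
        rw [div_lt_iff₀ hθ]; nlinarith
      have h2 : Tendsto (fun t : ℝ => t ^ (r - 1)) atTop (𝓝 0) := by
        simpa using tendsto_rpow_neg_atTop (sub_pos.2 hr)
      have h3 : Tendsto (fun t : ℝ => α - r * t ^ (r - 1) - 1 / θ) atTop (𝓝 (α - 1 / θ)) := by
        simpa using ((h2.const_mul r).const_sub α).sub_const (1 / θ)
      exact ⟨(α - 1 / θ) / 2, half_pos (sub_pos.2 h1),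
        h3.eventually_const_le (half_lt_self (sub_pos.2 h1))⟩
    · obtain ⟨h1, h2⟩ := hparam.2 rfl
      refine ⟨α - 1 - 1 / θ, ?_, Eventually.of_forall fun t => by simp⟩
      rw [div_le_iff₀ (by positivity)] at h1
      have h3 : 1 / θ < α - 1 := by rw [div_lt_iff₀ hθ]; nlinarith
      exact sub_pos.2 h3
  obtain ⟨t₂, ht₂⟩ := eventually_atTop.1 ha
  obtain ⟨t₁, h01, h11, h21⟩ : ∃ t₁, t₀ ≤ t₁ ∧ 1 ≤ t₁ ∧ t₂ ≤ t₁ :=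
    ⟨max t₀ (max 1 t₂), le_max_left _ _, (le_max_left _ _).trans (le_max_right _ _),
      (le_max_right _ _).trans (le_max_right _ _)⟩
  have hsub : ∀ t ∈ Ici t₁, t ∈ Ici t₀ := fun t ht => h01.trans ht
  have h1t : ∀ t ∈ Ici t₁, 1 ≤ t := fun t ht => h11.trans ht
  have hpos : ∀ t ∈ Ici t₁, 0 < t := fun t ht => one_pos.trans_le (h1t t ht)
  have hβ'0 : ∀ t ∈ Ici t₁, 0 ≤ β' t := fun t ht => by
    rw [← (hβderiv t (hsub t ht)).hasDerivWithinAt.derivWithin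
      (uniqueDiffOn_Ici t₀ t (hsub t ht))]
    exact hβmono.derivWithin_nonneg
  have key := tendsto_zero_and_bounded_of_inertial (τ := fun t => t ^ r)
    (τ' := fun t => r * t ^ (r - 1)) (τ'' := fun t => r * ((r - 1) * t ^ (r - 1 - 1)))
    (g := fun t => θ * (t ^ (2 * r) * β t))
    (g' := fun t => θ * (2 * r * t ^ (2 * r - 1) * β t + t ^ (2 * r) * β' t))
    (δ := 1 / θ - c) (z' := z') (w := w) (one_pos.trans_le h11) hθ ha₀ (sub_pos.2 hc)
    (fun t ht => hu t (hsub t ht))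
    (fun t ht => hz t (hsub t ht)) (fun t ht => hV t (hsub t ht))
    (fun t ht => Real.hasDerivAt_rpow_const (Or.inl (hpos t ht).ne'))
    (fun t ht => (Real.hasDerivAt_rpow_const (Or.inl (hpos t ht).ne')).const_mul r)
    (fun t ht => ((Real.hasDerivAt_rpow_const (Or.inl (hpos t ht).ne')).mul
      (hβderiv t (hsub t ht))).const_mul θ)
    (fun t ht => Real.rpow_pos_of_pos (hpos t ht) r)
    (fun t ht => (Real.rpow_le_rpow_of_exponent_le (h1t t ht) hr1).trans_eq (Real.rpow_one t))
    (fun t ht => mul_nonneg hr0 (Real.rpow_nonneg (hpos t ht).le _))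
    (fun t ht => mul_nonpos_of_nonneg_of_nonpos hr0 (mul_nonpos_of_nonpos_of_nonneg
      (sub_nonpos.2 hr1) (Real.rpow_nonneg (hpos t ht).le _)))
    (fun t ht => by
      have := hβpos t (hsub t ht); have := hpos t ht; positivity)
    (fun t ht => by
      have := hβpos t (hsub t ht); have := hpos t ht; have := hβ'0 t ht; positivity)
    (fun t ht => ht₂ t (h21.trans ht))
    (fun t ht => by
      have hb := hβpos t (hsub t ht)
      have ht0 := hpos t ht
      have hp := Real.rpow_pos_of_pos ht0 (2 * r)
      refine sub_le_sub_left (le_of_eq_of_le ?_ (hgrowth t (hsub t ht))) _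
      rw [Real.rpow_sub_one ht0.ne']
      field_simp
      ring)
    (fun t ht => huV t (hsub t ht)) (fun t ht => hzw t (hsub t ht))
    (fun t ht => by
      have ht0 := hpos t ht
      have hp := Real.rpow_pos_of_pos ht0 r
      have h2 : t ^ (2 * r) = t ^ r * t ^ r := by rw [two_mul, Real.rpow_add ht0]
      have h := congrArg (fun v => t ^ r • v) (heq t (hsub t ht))
      simp only [smul_add, smul_smul, smul_zero] at h
      rw [← h]
      simp only [h2]
      have e1 : t ^ r * (α / t ^ r) = α := by field_simp
      have e2 : t ^ r * (θ * t ^ r * β t) = θ * (t ^ r * t ^ r * β t) := by ring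
      have e3 : θ * (t ^ r * t ^ r * β t) / (θ * t ^ r) = t ^ r * β t := by field_simp
      rw [e1, e2, e3])
  refine ⟨?_, key.2.imp fun M hM => (eventually_ge_atTop t₁).mono hM⟩
  have := key.1.const_mul θ⁻¹
  rw [mul_zero] at this
  refine this.congr fun t => ?_
  field_simp

theorem ConvexOn.add_inner_gradient_le {X : Type*} [NormedAddCommGroup X] [InnerProductSpace ℝ X]
    [CompleteSpace X] {f : X → ℝ} (hconv : ConvexOn ℝ univ f) {x : X}
    (hf : DifferentiableAt ℝ f x) (y : X) : f x + inner ℝ (gradient f x) (y - x) ≤ f y := by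
  have h1 : ConvexOn ℝ univ (f ∘ AffineMap.lineMap (k := ℝ) x y) := hconv.comp_affineMap _
  have h2 : HasDerivAt (f ∘ AffineMap.lineMap (k := ℝ) x y) (inner ℝ (gradient f x) (y - x)) 0 := by
    have := hf.hasGradientAt.hasFDerivAt
    rw [← AffineMap.lineMap_apply_zero (k := ℝ) x y] at this
    simpa using this.comp_hasDerivAt (0 : ℝ) AffineMap.hasDerivAt_lineMap
  have h3 := h1.le_slope_of_hasDerivAt (mem_univ 0) (mem_univ 1) one_pos h2
  simp only [slope_def_field, Function.comp_apply, AffineMap.lineMap_apply_one,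
    AffineMap.lineMap_apply_zero, sub_zero, div_one] at h3
  linarith

theorem ConvexOn.inner_gradient_sub_nonneg {X : Type*} [NormedAddCommGroup X]
    [InnerProductSpace ℝ X] [CompleteSpace X] {f : X → ℝ} (hconv : ConvexOn ℝ univ f)
    (hf : Differentiable ℝ f) (x y : X) :
    0 ≤ inner ℝ (gradient f x - gradient f y) (x - y) := by
  have h1 := hconv.add_inner_gradient_le (hf x) y
  have h2 := hconv.add_inner_gradient_le (hf y) x
  rw [← neg_sub x y, inner_neg_right] at h1
  rw [inner_sub_left]
  linarith

theorem ConvexOn.norm_gradient_sub_sq_le {X : Type*} [NormedAddCommGroup X]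
    [InnerProductSpace ℝ X] [CompleteSpace X] {f : X → ℝ} (hconv : ConvexOn ℝ univ f)
    (hf : Differentiable ℝ f) {L : ℝ} (hL : 0 < L)
    (hLip : ∀ u v : X, ‖gradient f u - gradient f v‖ ≤ L * ‖u - v‖) (x y : X) :
    ‖gradient f x - gradient f y‖ ^ 2
      ≤ 4 * L * inner ℝ (gradient f x - gradient f y) (x - y) := by
  obtain ⟨d, hd⟩ : ∃ d, d = gradient f x - gradient f y := ⟨_, rfl⟩
  have hgx : gradient f x = d + gradient f y := by rw [hd]; abel
  have h1 := hconv.add_inner_gradient_le (hf y) (x - (1 / (2 * L)) • d)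
  have h2 := hconv.add_inner_gradient_le (hf x) y
  have h3 := hconv.add_inner_gradient_le (hf (x - (1 / (2 * L)) • d)) x
  have h4 : inner ℝ (gradient f x - gradient f (x - (1 / (2 * L)) • d)) ((1 / (2 * L)) • d)
      ≤ 1 / (4 * L) * ‖d‖ ^ 2 := by
    refine (real_inner_le_norm _ _).trans ((mul_le_mul_of_nonneg_right (hLip _ _)
      (norm_nonneg _)).trans_eq ?_)
    rw [sub_sub_cancel, norm_smul, Real.norm_of_nonneg (by positivity)]
    field_simp
    ring
  rw [sub_sub_cancel] at h3
  rw [inner_sub_left] at h4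
  have h5 : x - (1 / (2 * L)) • d - y = (x - y) - (1 / (2 * L)) • d := by abel
  rw [h5, inner_sub_right] at h1
  rw [← neg_sub x y, inner_neg_right] at h2
  rw [hgx, inner_add_left] at h2 h4
  rw [← hd]
  simp only [real_inner_smul_right, real_inner_self_eq_norm_sq] at h1 h3 h4
  have h6 : 1 / (4 * L) * ‖d‖ ^ 2 ≤ inner ℝ d (x - y) := by
    have : 1 / (2 * L) * ‖d‖ ^ 2 = 2 * (1 / (4 * L) * ‖d‖ ^ 2) := by field_simp; ring
    linarith
  rw [one_div, inv_mul_le_iff₀ (by positivity)] at h6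
  exact h6

theorem inner_deriv_nonneg_of_monotone {H : Type*} [NormedAddCommGroup H] [InnerProductSpace ℝ H]
    {u V : ℝ → H} {z w : H} {t : ℝ} (hu : HasDerivAt u z t) (hV : HasDerivAt V w t)
    (hmono : ∀ s, 0 ≤ inner ℝ (u s - u t) (V s - V t)) : 0 ≤ inner ℝ z w := by
  refine ge_of_tendsto (hu.tendsto_slope.inner hV.tendsto_slope) (Eventually.of_forall fun s => ?_)
  simp only [slope_def_module, real_inner_smul_left, real_inner_smul_right]
  rw [← mul_assoc]
  exact mul_nonneg (mul_self_nonneg _) (hmono s)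

/-- under an additional `L`-Lipschitz assumption on the gradient of `f`,
`t^ρ √(β(t)) ‖∇f(x(t)) − ∇f(x*)‖ → 0` and `t^ρ √(β(t)) ‖A*(λ(t) − λ*)‖ → 0`. -/
theorem statement6
    {X Y : Type*} [NormedAddCommGroup X] [InnerProductSpace ℝ X] [CompleteSpace X]
    [NormedAddCommGroup Y] [InnerProductSpace ℝ Y] [CompleteSpace Y]
    (f : X → ℝ) (hf : ContDiff ℝ 1 f) (hconv : ConvexOn ℝ Set.univ f)
    (A : X →L[ℝ] Y) (b : Y)
    (t₀ r α θ ρ : ℝ) (ht₀ : 0 < t₀) (hr0 : 0 ≤ r) (hr1 : r ≤ 1)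
    (hα : 0 < α) (hθpos : 0 < θ)
    (hparam : (r < 1 → 2 / α < θ) ∧ (r = 1 → 2 / (α + 1) ≤ θ ∧ θ < 1 / 2))
    (β β' : ℝ → ℝ)
    (hβpos : ∀ t ∈ Ici t₀, 0 < β t)
    (hβmono : MonotoneOn β (Ici t₀))
    (hβderiv : ∀ t ∈ Ici t₀, HasDerivAt β (β' t) t)
    (hβ'cont : ContinuousOn β' (Ici t₀))
    (hgrowth : ∃ c, c < 1 / θ ∧ ∀ t ∈ Ici t₀, t ^ r * (β' t / β t + 2 * r / t) ≤ c)
    (x x' x'' : ℝ → X) (lam lam' lam'' : ℝ → Y) (wx' : ℝ → X) (wy' : ℝ → Y)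
    (hx : ∀ t ∈ Ici t₀, HasDerivAt x (x' t) t)
    (hx' : ∀ t ∈ Ici t₀, HasDerivAt x' (x'' t) t)
    (hx''cont : ContinuousOn x'' (Ici t₀))
    (hlam : ∀ t ∈ Ici t₀, HasDerivAt lam (lam' t) t)
    (hlam' : ∀ t ∈ Ici t₀, HasDerivAt lam' (lam'' t) t)
    (hlam''cont : ContinuousOn lam'' (Ici t₀))
    (hwx : ∀ t ∈ Ici t₀, HasDerivAt
      (fun s => gradient f (x s) + ContinuousLinearMap.adjoint A (lam s)) (wx' t) t)
    (hwx'cont : ContinuousOn wx' (Ici t₀))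
    (hwy : ∀ t ∈ Ici t₀, HasDerivAt (fun s => b - A (x s)) (wy' t) t)
    (hwy'cont : ContinuousOn wy' (Ici t₀))
    (heqx : ∀ t ∈ Ici t₀,
      x'' t + (α / t ^ r) • x' t + (θ * t ^ r * β t) • wx' t
        + β t • (gradient f (x t) + ContinuousLinearMap.adjoint A (lam t)) = 0)
    (heqy : ∀ t ∈ Ici t₀,
      lam'' t + (α / t ^ r) • lam' t + (θ * t ^ r * β t) • wy' t
        + β t • (b - A (x t)) = 0)
    (xs : X) (ls : Y)
    (hsol1 : gradient f xs + ContinuousLinearMap.adjoint A ls = 0)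
    (hsol2 : A xs = b)
    (L : ℝ) (hL : 0 < L)
    (hLip : ∀ u v : X, ‖gradient f u - gradient f v‖ ≤ L * ‖u - v‖)
    (hρ : (r = 0 ∧ ρ = 0) ∨ (r = 1 ∧ ρ = 1) ∨
      (0 < r ∧ r < 1 ∧ ((0 < ρ ∧ ρ < r) ∨
        (ρ = r ∧ ∃ M : ℝ, ∀ t ∈ Ici t₀, ‖x t‖ ≤ M ∧ ‖lam t‖ ≤ M)))) :
    Tendsto (fun t : ℝ => t ^ ρ * Real.sqrt (β t) * ‖gradient f (x t) - gradient f xs‖)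
      atTop (𝓝 0) ∧
    Tendsto (fun t : ℝ => t ^ ρ * Real.sqrt (β t) * ‖ContinuousLinearMap.adjoint A (lam t - ls)‖)
      atTop (𝓝 0) := by
  have hfd : Differentiable ℝ f := hf.differentiable one_ne_zero
  have hgx : ∀ y, gradient f y + ContinuousLinearMap.adjoint A ls = gradient f y - gradient f xs :=
    fun y => by rw [eq_neg_of_add_eq_zero_left hsol1, sub_neg_eq_add]
  have hVx : ∀ t, gradient f (x t) + ContinuousLinearMap.adjoint A (lam t)
      = gradient f (x t) - gradient f xs + ContinuousLinearMap.adjoint A (lam t - ls) := fun t => by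
    rw [← hgx, map_sub]; abel
  have hskew : ∀ (p : X) (q : Y) (v : X),
      inner ℝ (WithLp.toLp 2 (p, q)) (WithLp.toLp 2 (v + ContinuousLinearMap.adjoint A q, -A p))
        = inner ℝ v p := fun p q v => by
    rw [WithLp.prod_inner_apply]
    simp only [inner_add_right, inner_neg_right, ContinuousLinearMap.adjoint_inner_right]
    rw [real_inner_comm q (A p), real_inner_comm p v]
    ring
  have hV : ∀ t, (WithLp.toLp 2 (gradient f (x t) + ContinuousLinearMap.adjoint A (lam t),
      b - A (x t)) : WithLp 2 (X × Y)) = WithLp.toLp 2 (gradient f (x t) - gradient f xs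
        + ContinuousLinearMap.adjoint A (lam t - ls), -A (x t - xs)) := fun t => by
    rw [hVx, map_sub A, hsol2, neg_sub]
  have hpair : ∀ {p : ℝ → X} {q : ℝ → Y} {p' : X} {q' : Y} {t : ℝ}, HasDerivAt p p' t →
      HasDerivAt q q' t → HasDerivAt (fun s => (WithLp.toLp 2 (p s, q s) : WithLp 2 (X × Y)))
        (WithLp.toLp 2 (p', q')) t := fun hp hq =>
    (WithLp.prodContinuousLinearEquiv 2 ℝ X Y).symm.hasFDerivAt.comp_hasDerivAt _ (hp.prodMk hq)
  obtain ⟨hlim, M, hM⟩ := tendsto_zero_and_bounded_of_rpow hr0 hr1 hα hθpos hparam hβpos hβmono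
    hβderiv hgrowth (u := fun t => (WithLp.toLp 2 (x t - xs, lam t - ls) : WithLp 2 (X × Y)))
    (V := fun t => (WithLp.toLp 2 (gradient f (x t) + ContinuousLinearMap.adjoint A (lam t),
      b - A (x t)) : WithLp 2 (X × Y)))
    (z' := fun t => WithLp.toLp 2 (x'' t, lam'' t)) (w := fun t => WithLp.toLp 2 (wx' t, wy' t))
    (fun t ht => hpair ((hx t ht).sub_const xs) ((hlam t ht).sub_const ls))
    (fun t ht => hpair (hx' t ht) (hlam' t ht)) (fun t ht => hpair (hwx t ht) (hwy t ht))
    (fun t ht => by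
      rw [hV, hskew]
      exact hconv.inner_gradient_sub_nonneg hfd _ _)
    (fun t ht => by
      refine inner_deriv_nonneg_of_monotone (hpair (hx t ht) (hlam t ht))
        (hpair (hwx t ht) (hwy t ht)) fun s => ?_
      have h := hskew (x s - x t) (lam s - lam t) (gradient f (x s) - gradient f (x t))
      refine (hconv.inner_gradient_sub_nonneg hfd (x s) (x t)).trans_eq (h.symm.trans ?_)
      rw [← WithLp.toLp_sub, ← WithLp.toLp_sub, Prod.mk_sub_mk, Prod.mk_sub_mk, map_sub, map_sub]
      congr 3
      · abel
      · abel)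
    (fun t ht => by
      simp only [← WithLp.toLp_smul, ← WithLp.toLp_add, Prod.smul_mk, Prod.mk_add_mk, heqx t ht,
        heqy t ht]
      rfl)
  obtain ⟨N, hN⟩ : ∃ N : ℝ → ℝ, N = fun t => ‖(WithLp.toLp 2 (gradient f (x t)
    + ContinuousLinearMap.adjoint A (lam t), b - A (x t)) : WithLp 2 (X × Y))‖ := ⟨_, rfl⟩
  have hN0 : ∀ t, 0 ≤ N t := fun t => by rw [hN]; exact norm_nonneg _
  replace hlim : Tendsto (fun t => t ^ (2 * r) * β t * N t) atTop (𝓝 0) := by rw [hN]; exact hlim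
  have hρr : ρ ≤ r ∧ 0 ≤ ρ := by
    rcases hρ with ⟨rfl, rfl⟩ | ⟨rfl, rfl⟩ | ⟨h0, -, ⟨h1, h2⟩ | ⟨rfl, -⟩⟩
    exacts [⟨le_rfl, le_rfl⟩, ⟨le_rfl, zero_le_one⟩, ⟨h2.le, h1.le⟩, ⟨le_rfl, h0.le⟩]
  have hβ0 := hβpos t₀ self_mem_Ici
  have hgrad : Tendsto (fun t : ℝ => t ^ ρ * √(β t) * ‖gradient f (x t) - gradient f xs‖)
      atTop (𝓝 0) := by
    have hsq : Tendsto (fun t : ℝ => √(4 * L * M * (t ^ (2 * r) * β t * N t))) atTop (𝓝 0) := by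
      simpa only [mul_zero, Real.sqrt_zero] using (hlim.const_mul (4 * L * M)).sqrt
    refine squeeze_zero' ?_ ?_ hsq
    · filter_upwards [eventually_ge_atTop 0] with t ht
      positivity
    · filter_upwards [eventually_ge_atTop (max t₀ 1), hM] with t ht hMt
      have ht1 : 1 ≤ t := (le_max_right _ _).trans ht
      have ht0 : 0 < t := one_pos.trans_le ht1
      have hβt := hβpos t ((le_max_left _ _).trans ht)
      refine Real.le_sqrt_of_sq_le ?_
      have h1 := hconv.norm_gradient_sub_sq_le hfd hL hLip (x t) xs
      have h2 : inner ℝ (gradient f (x t) - gradient f xs) (x t - xs) ≤ M * N t := by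
        rw [← hskew _ (lam t - ls), ← hV, hN]
        exact (real_inner_le_norm _ _).trans (mul_le_mul_of_nonneg_right hMt (norm_nonneg _))
      have h3 : (t ^ ρ) ^ 2 ≤ t ^ (2 * r) := by
        rw [← Real.rpow_mul_natCast ht0.le]
        refine Real.rpow_le_rpow_of_exponent_le ht1 ?_
        push_cast
        linarith
      rw [mul_pow, mul_pow, Real.sq_sqrt hβt.le]
      calc (t ^ ρ) ^ 2 * β t * ‖gradient f (x t) - gradient f xs‖ ^ 2
          ≤ t ^ (2 * r) * β t * (4 * L * (M * N t)) := by
            gcongr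
            exact h1.trans (by gcongr)
        _ = _ := by ring
  have hVlim : Tendsto (fun t : ℝ => t ^ ρ * √(β t) * N t) atTop (𝓝 0) := by
    have h0 : Tendsto (fun t : ℝ => (√(β t₀))⁻¹ * (t ^ (2 * r) * β t * N t)) atTop (𝓝 0) := by
      simpa only [mul_zero] using hlim.const_mul (√(β t₀))⁻¹
    refine squeeze_zero' ?_ ?_ h0
    · filter_upwards [eventually_ge_atTop 0] with t ht
      have := hN0 t
      positivity
    · filter_upwards [eventually_ge_atTop (max t₀ 1)] with t ht
      have ht1 : 1 ≤ t := (le_max_right _ _).trans ht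
      have htt : t ∈ Ici t₀ := (le_max_left _ _).trans ht
      have h1 : t ^ ρ ≤ t ^ (2 * r) := Real.rpow_le_rpow_of_exponent_le ht1 (by linarith)
      have h2 : √(β t) ≤ (√(β t₀))⁻¹ * β t := by
        have h3 : √(β t₀) ≤ √(β t) := Real.sqrt_le_sqrt (hβmono self_mem_Ici htt htt)
        rw [inv_mul_eq_div, le_div_iff₀ (Real.sqrt_pos.2 hβ0)]
        nlinarith [Real.mul_self_sqrt (hβpos t htt).le, Real.sqrt_nonneg (β t)]
      have h4 := hN0 t
      calc t ^ ρ * √(β t) * N t ≤ t ^ (2 * r) * ((√(β t₀))⁻¹ * β t) * N t := by gcongr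
        _ = _ := by ring
  refine ⟨hgrad, ?_⟩
  have hsum := hVlim.add hgrad
  rw [add_zero] at hsum
  refine squeeze_zero' ?_ ?_ hsum
  · filter_upwards [eventually_ge_atTop 0] with t ht
    positivity
  · filter_upwards [eventually_ge_atTop 0] with t ht
    rw [← mul_add]
    refine mul_le_mul_of_nonneg_left ?_ (by positivity)
    have h1 : ContinuousLinearMap.adjoint A (lam t - ls) = (gradient f (x t)
        + ContinuousLinearMap.adjoint A (lam t)) - (gradient f (x t) - gradient f xs) := by
      rw [hVx]; abel
    rw [h1, hN]
    exact (norm_sub_le _ _).trans (add_le_add_left (WithLp.norm_fst_le _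
      (WithLp.toLp 2 (gradient f (x t) + ContinuousLinearMap.adjoint A (lam t), b - A (x t)))) _)
end

section
/- Let r ∈ (0,1), θ > 0 and 0 < δ < 1/(2θ), and define the sequence β_k = k^(−2r) · exp((1/(2θ) − δ) k^(1−r)/(1−r)) for integers k ≥ 1. Then lim_{k→∞} k^r ((β_k − β_(k−1))/β_k + 2r/k) = 1/(2θ) − δ. Consequently, there exists a positive integer k₀ such that sup_{k ≥ k₀} k^r ((β_k − β_(k−1))/β_k + 2r/k) < 1/(2θ). -/
open Filter Topology Set

/-- The difference quotients of `f` at `0` along the sequence `1 / k`. -/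
theorem tendsto_natCast_mul_sub_inv {f : ℝ → ℝ} {f' : ℝ} (hf : HasDerivAt f f' 0) :
    Tendsto (fun k : ℕ => (k : ℝ) * (f ((k : ℝ)⁻¹) - f 0)) atTop (𝓝 f') := by
  have h := (hasDerivAt_iff_tendsto_slope_zero.1 hf).mono_left
    (nhdsWithin_mono 0 fun x (hx : 0 < x) => hx.ne')
  have hinv : Tendsto (fun k : ℕ => (k : ℝ)⁻¹) atTop (𝓝[>] 0) :=
    tendsto_inv_atTop_nhdsGT_zero.comp tendsto_natCast_atTop_atTop
  simpa [Function.comp_def] using h.comp hinv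

/-- If `a k → ∞` and `a k * u k → L`, then `a k * (1 - exp (-u k)) → L`. -/
theorem tendsto_mul_one_sub_exp_neg {ι : Type*} {l : Filter ι} {a u : ι → ℝ} {L : ℝ}
    (ha : Tendsto a l atTop) (hau : Tendsto (fun i => a i * u i) l (𝓝 L)) :
    Tendsto (fun i => a i * (1 - Real.exp (-u i))) l (𝓝 L) := by
  have hu : Tendsto u l (𝓝 0) := by
    have h := (tendsto_inv_atTop_zero.comp ha).mul hau
    rw [zero_mul] at h
    refine h.congr' ?_
    filter_upwards [ha.eventually_gt_atTop 0] with i hi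
    simp only [Function.comp_apply]
    field_simp
  have hg : HasDerivAt (fun x : ℝ => 1 - Real.exp (-x)) 1 0 := by
    simpa using ((hasDerivAt_neg (0 : ℝ)).exp).const_sub 1
  have hd : Tendsto (dslope (fun x : ℝ => 1 - Real.exp (-x)) 0) (𝓝 0) (𝓝 1) := by
    have h := (continuousAt_dslope_same.2 hg.differentiableAt).tendsto
    rwa [dslope_same, hg.deriv] at h
  have h := hau.mul (hd.comp hu)
  rw [mul_one] at h
  refine h.congr fun i => ?_
  have h' := sub_smul_dslope (fun x : ℝ => 1 - Real.exp (-x)) 0 (u i)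
  simp only [sub_zero, smul_eq_mul, neg_zero, Real.exp_zero, sub_self] at h'
  rw [Function.comp_apply, mul_assoc, h']

/-- The relative backward difference of `k ^ (-(2 * r)) * exp (c * k ^ (1 - r) / (1 - r))`,
written through `k⁻¹`. -/
theorem backward_difference_eq {r c x y : ℝ} (hx : 0 < x) (hy : 0 < 1 - x⁻¹)
    (hyx : y = x * (1 - x⁻¹)) :
    (x ^ (-(2 * r)) * Real.exp (c * x ^ (1 - r) / (1 - r)) -
        y ^ (-(2 * r)) * Real.exp (c * y ^ (1 - r) / (1 - r))) /
      (x ^ (-(2 * r)) * Real.exp (c * x ^ (1 - r) / (1 - r))) =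
    1 - Real.exp (-(2 * r * Real.log (1 - x⁻¹) +
      c / (1 - r) * (x ^ (1 - r) * (1 - (1 - x⁻¹) ^ (1 - r))))) := by
  have hxp : 0 < x ^ (-(2 * r)) := Real.rpow_pos_of_pos hx _
  rw [sub_div, div_self (by positivity), hyx, Real.mul_rpow hx.le hy.le,
    Real.mul_rpow hx.le hy.le, Real.rpow_def_of_pos hy (-(2 * r)),
    mul_assoc, mul_div_mul_left _ _ hxp.ne', ← Real.exp_add, ← Real.exp_sub]
  congr 2
  ring

/-- The limit of `k ^ r` times the relative backward difference. -/
theorem tendsto_rpow_mul_backward_difference {r c : ℝ} (hr0 : 0 < r) (hr1 : r < 1) :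
    Tendsto (fun k : ℕ => (k : ℝ) ^ r * (1 - Real.exp (-(2 * r * Real.log (1 - (k : ℝ)⁻¹) +
      c / (1 - r) * ((k : ℝ) ^ (1 - r) * (1 - (1 - (k : ℝ)⁻¹) ^ (1 - r)))))))
      atTop (𝓝 c) := by
  have hr : 1 - r ≠ 0 := by linarith
  refine tendsto_mul_one_sub_exp_neg
    ((tendsto_rpow_atTop hr0).comp tendsto_natCast_atTop_atTop) ?_
  have hsub : HasDerivAt (fun x : ℝ => 1 - x) (-1) 0 := by
    simpa using (hasDerivAt_id (0 : ℝ)).const_sub 1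
  have hlog := tendsto_natCast_mul_sub_inv (hsub.log (by norm_num))
  have hpow := tendsto_natCast_mul_sub_inv (hsub.rpow_const (p := 1 - r) (by norm_num))
  have hdecay : Tendsto (fun k : ℕ => (k : ℝ) ^ (-(1 - r))) atTop (𝓝 0) :=
    (tendsto_rpow_neg_atTop (by linarith)).comp tendsto_natCast_atTop_atTop
  have h := ((hdecay.mul hlog).const_mul (2 * r)).sub (hpow.const_mul (c / (1 - r)))
  have hlim : 2 * r * (0 * (-1 / (1 - 0))) -
      c / (1 - r) * (-1 * (1 - r) * (1 - 0) ^ (1 - r - 1)) = c := by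
    rw [sub_zero, Real.one_rpow]
    field_simp
    ring
  rw [hlim] at h
  refine h.congr' ?_
  filter_upwards [eventually_gt_atTop 0] with k hk
  have hk' : (0 : ℝ) < k := by exact_mod_cast hk
  have h1 : (k : ℝ) ^ (-(1 - r)) * k = (k : ℝ) ^ r := by
    rw [← Real.rpow_add_one hk'.ne']
    congr 1
    ring
  have h2 : (k : ℝ) ^ r * (k : ℝ) ^ (1 - r) = k := by
    rw [← Real.rpow_add hk', add_sub_cancel, Real.rpow_one]
  simp only [sub_zero, Real.log_one, Real.one_rpow]
  linear_combination (2 * r * Real.log (1 - (k : ℝ)⁻¹)) * h1 -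
    (c / (1 - r) * (1 - (1 - (k : ℝ)⁻¹) ^ (1 - r))) * h2

/-- for `r ∈ (0,1)`, `θ > 0` and `0 < δ < 1/(2θ)`, the sequence
`β_k = k^(−2r) · exp((1/(2θ) − δ) k^(1−r)/(1−r))` (for `k ≥ 1`) satisfies
`k^r ((β_k − β_(k−1))/β_k + 2r/k) → 1/(2θ) − δ`; consequently there is `k₀ ≥ 1` with
`sup_{k ≥ k₀} k^r ((β_k − β_(k−1))/β_k + 2r/k) < 1/(2θ)`. -/
theorem statement12 (r θ δ : ℝ) (hr0 : 0 < r) (hr1 : r < 1)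
    (hθ : 0 < θ) (hδ0 : 0 < δ) (hδ : δ < 1 / (2 * θ))
    (β : ℕ → ℝ)
    (hβ : ∀ k : ℕ, 1 ≤ k →
      β k = (k : ℝ) ^ (-(2 * r)) * Real.exp ((1 / (2 * θ) - δ) * (k : ℝ) ^ (1 - r) / (1 - r))) :
    Tendsto (fun k : ℕ => (k : ℝ) ^ r * ((β k - β (k - 1)) / β k + 2 * r / (k : ℝ)))
      atTop (𝓝 (1 / (2 * θ) - δ)) ∧
    ∃ k₀ : ℕ, 0 < k₀ ∧ ∃ c, c < 1 / (2 * θ) ∧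
      ∀ k, k₀ ≤ k → (k : ℝ) ^ r * ((β k - β (k - 1)) / β k + 2 * r / (k : ℝ)) ≤ c := by
  have hlim : Tendsto (fun k : ℕ => (k : ℝ) ^ r * ((β k - β (k - 1)) / β k + 2 * r / (k : ℝ)))
      atTop (𝓝 (1 / (2 * θ) - δ)) := by
    have hdecay : Tendsto (fun k : ℕ => (k : ℝ) ^ (-(1 - r))) atTop (𝓝 0) :=
      (tendsto_rpow_neg_atTop (by linarith)).comp tendsto_natCast_atTop_atTop
    have h := (tendsto_rpow_mul_backward_difference (c := 1 / (2 * θ) - δ) hr0 hr1).add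
      (hdecay.const_mul (2 * r))
    rw [mul_zero, add_zero] at h
    refine h.congr' ?_
    filter_upwards [eventually_ge_atTop 2] with k hk
    have hk' : (1 : ℝ) < k := by exact_mod_cast hk
    have hk0 : (0 : ℝ) < k := by linarith
    have hpred : ((k - 1 : ℕ) : ℝ) = k * (1 - (k : ℝ)⁻¹) := by
      rw [Nat.cast_pred (by lia)]
      field_simp
    have hpow : (k : ℝ) ^ (-(1 - r)) = (k : ℝ) ^ r / k := by
      rw [← Real.rpow_sub_one hk0.ne']
      congr 1
      ring
    rw [hβ k (by lia), hβ (k - 1) (by lia),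
      backward_difference_eq hk0 (sub_pos.2 (inv_lt_one_of_one_lt₀ hk')) hpred, hpow]
    ring
  refine ⟨hlim, ?_⟩
  obtain ⟨c, hc, hcθ⟩ := exists_between (sub_lt_self (1 / (2 * θ)) hδ0)
  obtain ⟨N, hN⟩ := eventually_atTop.1 (hlim.eventually_le_const hc)
  exact ⟨N + 1, N.succ_pos, c, hcθ, fun k hk => hN k (by lia)⟩
end

section
/- Let a > 0, r ∈ [0,1], t₀ > 0, ℓ ∈ ℝ, and let q : [t₀, ∞) → ℝ be continuously differentiable such that q(t) + (t^r / a) q'(t) → ℓ as t → ∞. Then q(t) → ℓ as t → ∞. -/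
open Filter Topology Set

/-- An eventual strict upper bound `M` for `q + (t ^ r / a) q'` is asymptotically an upper bound
for `q`: the function `M + K t ^ (-a)` is a barrier for `q`. -/
theorem eventually_lt_of_add_rpow_mul_deriv_lt {a r t₀ M N : ℝ} (ha : 0 < a) (hr1 : r ≤ 1)
    {q q' : ℝ → ℝ} (hq : ∀ t ∈ Ici t₀, HasDerivAt q (q' t) t)
    (hM : ∀ᶠ t : ℝ in atTop, q t + t ^ r / a * q' t < M) (hMN : M < N) :
    ∀ᶠ t in atTop, q t < N := by
  obtain ⟨T₁, hT₁⟩ := eventually_atTop.1 hM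
  obtain ⟨T, hT₁T, hT1, hT₀⟩ : ∃ T, T₁ ≤ T ∧ 1 ≤ T ∧ t₀ ≤ T :=
    ⟨max T₁ (max 1 t₀), by simp, by simp, by simp⟩
  have hTpos : 0 < T := by linarith
  obtain ⟨K, hK, hKT⟩ : ∃ K : ℝ, 0 < K ∧ q T - M ≤ K * T ^ (-a) := by
    have hp : 0 < T ^ (-a) := Real.rpow_pos_of_pos hTpos _
    refine ⟨(|q T - M| + 1) / T ^ (-a), by positivity, ?_⟩
    rw [div_mul_cancel₀ _ hp.ne']
    linarith [le_abs_self (q T - M)]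
  have hB : ∀ t : ℝ, 0 < t →
      HasDerivAt (fun t : ℝ => M + K * t ^ (-a)) (K * (-a * t ^ (-a - 1))) t := fun t ht =>
    ((Real.hasDerivAt_rpow_const (Or.inl ht.ne')).const_mul K).const_add M
  have barrier : ∀ t, T ≤ t → q t ≤ M + K * t ^ (-a) := by
    intro t ht
    refine image_le_of_deriv_right_lt_deriv_boundary' (a := T) (b := t) (f' := q')
      (B' := fun t => K * (-a * t ^ (-a - 1)))
      (fun x hx => (hq x (hT₀.trans hx.1)).continuousAt.continuousWithinAt)
      (fun x hx => (hq x (hT₀.trans hx.1)).hasDerivWithinAt) (by linarith)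
      (fun x hx => (hB x (hTpos.trans_le hx.1)).continuousAt.continuousWithinAt)
      (fun x hx => (hB x (hTpos.trans_le hx.1)).hasDerivWithinAt) ?_ ⟨ht, le_rfl⟩
    intro x hx hqx
    have hx0 : 0 < x := hTpos.trans_le hx.1
    have h := hT₁ x (hT₁T.trans hx.1)
    have hr : x ^ r ≤ x := by
      simpa using Real.rpow_le_rpow_of_exponent_le (hT1.trans hx.1) hr1
    have hrpos : 0 < x ^ r := Real.rpow_pos_of_pos hx0 r
    have hp : 0 < x ^ (-a - 1) := Real.rpow_pos_of_pos hx0 _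
    have hxa : x ^ (-a) = x ^ (-a - 1) * x := by
      rw [← Real.rpow_add_one hx0.ne']; congr 1; ring
    rw [hqx, hxa] at h
    have hb : 0 < x ^ r / a := by positivity
    refine lt_of_mul_lt_mul_left (a := x ^ r / a) ?_ hb.le
    have e : x ^ r / a * (K * (-a * x ^ (-a - 1))) = -(K * x ^ (-a - 1) * x ^ r) := by
      field_simp
    rw [e]
    have := mul_le_mul_of_nonneg_left hr (by positivity : 0 ≤ K * x ^ (-a - 1))
    linarith
  have hlim : Tendsto (fun t : ℝ => M + K * t ^ (-a)) atTop (𝓝 M) := by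
    simpa using ((tendsto_rpow_neg_atTop ha).const_mul K).const_add M
  filter_upwards [hlim.eventually_lt_const hMN, eventually_ge_atTop T] with t h1 h2
  exact (barrier t h2).trans_lt h1

/-- if `q : [t₀, ∞) → ℝ` is continuously differentiable and
`q(t) + (t^r / a) q'(t) → ℓ` as `t → ∞` (with `a > 0`, `r ∈ [0,1]`, `t₀ > 0`),
then `q(t) → ℓ` as `t → ∞`. -/
theorem statement18 (a r t₀ ℓ : ℝ) (ha : 0 < a) (hr0 : 0 ≤ r) (hr1 : r ≤ 1)
    (ht₀ : 0 < t₀) (q q' : ℝ → ℝ)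
    (hq : ∀ t ∈ Ici t₀, HasDerivAt q (q' t) t)
    (hq'cont : ContinuousOn q' (Ici t₀))
    (hlim : Tendsto (fun t : ℝ => q t + t ^ r / a * q' t) atTop (𝓝 ℓ)) :
    Tendsto q atTop (𝓝 ℓ) := by
  refine tendsto_order.2 ⟨fun N hN => ?_, fun N hN => ?_⟩
  · obtain ⟨M, hNM, hM⟩ := exists_between hN
    have h := eventually_lt_of_add_rpow_mul_deriv_lt (q := fun t => -q t) (q' := fun t => -q' t)
      (M := -M) (N := -N) ha hr1 (fun t ht => (hq t ht).neg)
      ((hlim.eventually_const_lt hM).mono fun t ht => by linarith) (by linarith)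
    exact h.mono fun t ht => by linarith
  · obtain ⟨M, hM, hMN⟩ := exists_between hN
    exact eventually_lt_of_add_rpow_mul_deriv_lt ha hr1 hq (hlim.eventually_lt_const hM) hMN
end

section
/- Let a > 0, r ∈ [0,1], ℓ ∈ ℝ, and let (q_k)_{k≥1} be a sequence of real numbers such that q_(k+1) + (k^r / a)(q_(k+1) − q_k) → ℓ as k → ∞. Then q_k → ℓ as k → ∞. -/
open Filter Topology

/-- A nonnegative sequence with `v (k + 1) * (a / (k + 1)) ≤ v k - v (k + 1)` eventually
tends to zero, since the harmonic series diverges. -/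
lemma tendsto_zero_of_mul_div_succ_le_sub {a : ℝ} (ha : 0 < a) {v : ℕ → ℝ} (hv : ∀ k, 0 ≤ v k)
    {N : ℕ} (h : ∀ k ≥ N, v (k + 1) * (a * (1 / ((k : ℝ) + 1))) ≤ v k - v (k + 1)) :
    Tendsto v atTop (𝓝 0) := by
  set H : ℕ → ℝ := fun n => ∑ i ∈ Finset.range n, 1 / ((i : ℝ) + 1) with hH
  have hHt : Tendsto H atTop atTop := Real.tendsto_sum_range_one_div_nat_succ_atTop
  have hmono : Monotone H := monotone_nat_of_le_succ fun n => by
    simp only [hH, Finset.sum_range_succ]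
    have : (0 : ℝ) ≤ 1 / ((n : ℝ) + 1) := by positivity
    linarith
  have key : ∀ n ≥ N, v n * (1 + a * (H n - H N)) ≤ v N := by
    intro n hn
    induction n, hn using Nat.le_induction with
    | base => simp
    | succ n hn ih =>
      have hs : H (n + 1) = H n + 1 / ((n : ℝ) + 1) := Finset.sum_range_succ _ _
      have h1 := h n hn
      have h2 : 0 ≤ v (n + 1) * (a * (1 / ((n : ℝ) + 1))) := mul_nonneg (hv _) (by positivity)
      have h3 : 0 ≤ a * (H n - H N) := mul_nonneg ha.le (sub_nonneg.2 (hmono hn))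
      have h4 := mul_le_mul_of_nonneg_right (show v (n + 1) ≤ v n by linarith) h3
      rw [hs]
      linarith
  have hD : Tendsto (fun n => 1 + a * (H n - H N)) atTop atTop :=
    tendsto_atTop_add_const_left _ _
      ((tendsto_atTop_add_const_right _ (-H N) hHt).const_mul_atTop ha)
  refine tendsto_of_tendsto_of_tendsto_of_le_of_le' tendsto_const_nhds
    (hD.const_div_atTop (v N)) (Eventually.of_forall hv) ?_
  filter_upwards [eventually_ge_atTop N, hD.eventually_gt_atTop 0] with n hn hpos
  exact (le_div_iff₀ hpos).2 (key n hn)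

/-- if a real sequence `(q_k)` satisfies
`q_(k+1) + (k^r / a)(q_(k+1) − q_k) → ℓ` as `k → ∞` (with `a > 0`, `r ∈ [0,1]`),
then `q_k → ℓ` as `k → ∞`. -/
theorem statement19 (a r ℓ : ℝ) (ha : 0 < a) (hr0 : 0 ≤ r) (hr1 : r ≤ 1)
    (q : ℕ → ℝ)
    (hlim : Tendsto (fun k : ℕ => q (k + 1) + (k : ℝ) ^ r / a * (q (k + 1) - q k))
      atTop (𝓝 ℓ)) :
    Tendsto q atTop (𝓝 ℓ) := by
  rw [Metric.tendsto_atTop] at hlim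
  rw [Metric.tendsto_nhds]
  intro ε hε
  obtain ⟨N, hN⟩ := hlim (ε / 2) (by positivity)
  have hv : Tendsto (fun k => max (|q k - ℓ| - ε / 2) 0) atTop (𝓝 0) := by
    refine tendsto_zero_of_mul_div_succ_le_sub ha (fun k => le_max_right _ _) (N := N) ?_
    intro k hk
    have hd := hN k hk
    rw [Real.dist_eq] at hd
    have hc0 : 0 ≤ (k : ℝ) ^ r / a := by positivity
    have hc1 : (k : ℝ) ^ r / a ≤ ((k : ℝ) + 1) / a := by
      gcongr
      calc (k : ℝ) ^ r ≤ ((k : ℝ) + 1) ^ r := by gcongr; linarith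
        _ ≤ ((k : ℝ) + 1) ^ (1 : ℝ) :=
          Real.rpow_le_rpow_of_exponent_le (by linarith [k.cast_nonneg (α := ℝ)]) hr1
        _ = (k : ℝ) + 1 := Real.rpow_one _
    generalize (k : ℝ) ^ r / a = c at hd hc0 hc1
    have hstep : (1 + c) * |q (k + 1) - ℓ| ≤ c * |q k - ℓ| + ε / 2 := by
      calc (1 + c) * |q (k + 1) - ℓ| = |(1 + c) * (q (k + 1) - ℓ)| := by
            rw [abs_mul, abs_of_nonneg (by linarith : 0 ≤ 1 + c)]
        _ = |c * (q k - ℓ) + (q (k + 1) + c * (q (k + 1) - q k) - ℓ)| := by congr 1; ring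
        _ ≤ |c * (q k - ℓ)| + |q (k + 1) + c * (q (k + 1) - q k) - ℓ| := abs_add_le _ _
        _ ≤ c * |q k - ℓ| + ε / 2 := by rw [abs_mul, abs_of_nonneg hc0]; linarith
    set x := max (|q k - ℓ| - ε / 2) 0
    have hx0 : 0 ≤ x := le_max_right _ _
    have hx1 : |q k - ℓ| - ε / 2 ≤ x := le_max_left _ _
    rcases le_total (|q (k + 1) - ℓ| - ε / 2) 0 with h0 | h0
    · rw [max_eq_right h0]
      linarith
    · rw [max_eq_left h0]
      set y := |q (k + 1) - ℓ| - ε / 2 with hy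
      have hyc : y ≤ c * (x - y) := by nlinarith [mul_le_mul_of_nonneg_left hx1 hc0]
      have hyx : 0 ≤ x - y := by
        by_contra! hneg
        linarith [mul_nonpos_of_nonneg_of_nonpos hc0 hneg.le]
      have hk1 : (0 : ℝ) < (k : ℝ) + 1 := by positivity
      have hle : y ≤ ((k : ℝ) + 1) / a * (x - y) :=
        hyc.trans (mul_le_mul_of_nonneg_right hc1 hyx)
      calc y * (a * (1 / ((k : ℝ) + 1)))
          ≤ ((k : ℝ) + 1) / a * (x - y) * (a * (1 / ((k : ℝ) + 1))) := by gcongr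
        _ = x - y := by field_simp
  filter_upwards [hv.eventually_lt_const (half_pos hε)] with k hk
  rw [Real.dist_eq]
  linarith [le_max_left (|q k - ℓ| - ε / 2) 0]
end
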